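/- Let (X,d) be a bounded complete separable metric space and let μ₁, μ₂ be finite nonnegative Borel measures on X. Assume there exist constants C₁, C₂ > 0 such that for every bounded Lipschitz function ψ : X → ℝ it holds |∫_X ψ dμ₁ − ∫_X ψ dμ₂| ≤ C₁ Lip(ψ) + C₂ ‖ψ‖_∞, where Lip(ψ) is the Lipschitz constant of ψ. Then there exist nonnegative measures μ̃₁ ≤ μ₁ and μ̃₂ ≤ μ₂ with ‖μ₁ − μ̃₁‖ ≤ C₂, ‖μ₂ − μ̃₂‖ ≤ C₂, μ̃₁(X) = μ̃₂(X), and a nonnegative Borel measure π on X × X whose first and second marginals are μ̃₁ and μ̃₂ respectively, such that ∫_{X×X} d(x,y) dπ(x,y) ≤ C₁ + C₂ · diam(X). -/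

import Mathlib

open MeasureTheory Measure Metric Filter Set
open scoped ENNReal NNReal Topology

lemma aux_lp {X ι : Type*} [MetricSpace X] [Fintype ι] (x : ι → X) (a b : ι → ℝ)
    (ha : ∀ i, 0 ≤ a i) (hb : ∀ i, 0 ≤ b i) (M : ℝ)
    (hM : ∀ ψ : X → ℝ, LipschitzWith 1 ψ → (∀ z, ψ z ≤ 0) →
      ∑ i, ψ (x i) * (a i - b i) ≤ M) :
    ∃ p : ι → ι → ℝ, (∀ i j, 0 ≤ p i j) ∧ (∀ i, ∑ j, p i j ≤ a i) ∧
      (∀ j, ∑ i, p i j = b j) ∧ ∑ i, ∑ j, p i j * dist (x i) (x j) ≤ M := by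
  classical
  by_contra hcon
  let P : Set (ι → ι → ℝ) := {p | (∀ i j, 0 ≤ p i j) ∧ ∀ i, ∑ j, p i j ≤ a i}
  have hPclosed : IsClosed P := by
    have : P = (⋂ i, ⋂ j, {p : ι → ι → ℝ | 0 ≤ p i j}) ∩ ⋂ i, {p | ∑ j, p i j ≤ a i} := by
      ext p; simp [P]
    rw [this]
    refine IsClosed.inter ?_ ?_
    · exact isClosed_iInter fun i => isClosed_iInter fun j =>
        isClosed_le continuous_const (by fun_prop)
    · exact isClosed_iInter fun i => isClosed_le (by fun_prop) continuous_const
  have hPcomp : IsCompact P := by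
    refine IsCompact.of_isClosed_subset
      (isCompact_Icc (a := (0 : ι → ι → ℝ)) (b := fun i _ => a i)) hPclosed ?_
    rintro p ⟨h1, h2⟩
    refine ⟨fun i j => h1 i j, fun i j => ?_⟩
    exact (Finset.single_le_sum (fun k _ => h1 i k) (Finset.mem_univ j)).trans (h2 i)
  have hPconv : Convex ℝ P := by
    rintro p ⟨h1, h2⟩ q ⟨h3, h4⟩ s t hs ht hst
    refine ⟨fun i j => ?_, fun i => ?_⟩
    · have := h1 i j; have := h3 i j
      simp only [Pi.add_apply, Pi.smul_apply, smul_eq_mul]; positivity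
    · simp only [Pi.add_apply, Pi.smul_apply, smul_eq_mul, Finset.sum_add_distrib,
        ← Finset.mul_sum]
      have := mul_le_mul_of_nonneg_left (h2 i) hs
      have := mul_le_mul_of_nonneg_left (h4 i) ht
      have : s * a i + t * a i = a i := by rw [← add_mul, hst, one_mul]
      linarith
  let L : (ι → ι → ℝ) →ₗ[ℝ] ((ι → ℝ) × ℝ) :=
    { toFun := fun p => (fun j => ∑ i, p i j, ∑ i, ∑ j, p i j * dist (x i) (x j))
      map_add' := by
        intro p q
        ext <;> simp [Finset.sum_add_distrib, add_mul]
      map_smul' := by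
        intro c p
        ext <;> simp [Finset.mul_sum, mul_assoc] }
  have hLc : Continuous L := L.continuous_of_finiteDimensional
  let T : Set ((ι → ℝ) × ℝ) := {b} ×ˢ Iic M
  have hTconv : Convex ℝ T := (convex_singleton b).prod (convex_Iic M)
  have hTcl : IsClosed T := isClosed_singleton.prod isClosed_Iic
  have hdisj : Disjoint (L '' P) T := by
    rw [Set.disjoint_left]
    rintro _ ⟨p, ⟨h1, h2⟩, rfl⟩ ⟨h3, h4⟩
    exact hcon ⟨p, h1, h2, fun j => congrFun h3 j, h4⟩
  obtain ⟨f, u, v, hu, huv, hv⟩ := geometric_hahn_banach_compact_closed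
    (hPconv.linear_image L) (hPcomp.image hLc) hTconv hTcl hdisj
  set χ : ι → ℝ := fun j => f (Pi.single j 1, 0) with hχ
  set l : ℝ := f (0, 1) with hl
  have hf : ∀ y t, f (y, t) = ∑ j, χ j * y j + l * t := by
    intro y t
    have h : ((y, t) : (ι → ℝ) × ℝ)
        = ∑ j, y j • ((Pi.single j 1, 0) : (ι → ℝ) × ℝ) + t • ((0, 1) : (ι → ℝ) × ℝ) := by
      ext k
      · simp [Prod.fst_sum, Finset.sum_apply, Pi.single_apply]
      · simp [Prod.snd_sum]
    rw [h, map_add, _root_.map_sum]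
    simp only [map_smul, smul_eq_mul, hχ, hl]
    congr 1
    · exact Finset.sum_congr rfl fun _ _ => mul_comm _ _
    · exact mul_comm _ _
  have hM0 : 0 ≤ M := by
    have := hM (fun _ => 0) (LipschitzWith.const' 0 |>.weaken zero_le_one) (fun _ => le_rfl)
    simpa using this
  have hl0 : l ≤ 0 := by
    by_contra hl0
    push Not at hl0
    set c := (∑ j, χ j * b j) 
    have h := hv (b, min M ((v - c) / l)) ⟨rfl, Set.mem_Iic.2 (min_le_left _ _)⟩
    rw [hf] at h
    have h2 : l * min M ((v - c) / l) ≤ l * ((v - c) / l) :=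
      mul_le_mul_of_nonneg_left (min_le_right _ _) hl0.le
    rw [mul_div_cancel₀ _ hl0.ne'] at h2
    linarith
  -- perturb
  set δ := (v - u) / (M + 1) with hδ
  have hδ0 : 0 < δ := div_pos (by linarith) (by linarith)
  have hδM : δ * M ≤ v - u := by
    rw [hδ, div_mul_eq_mul_div, div_le_iff₀ (by linarith)]
    nlinarith
  set l' := δ - l with hl'
  have hl'0 : 0 < l' := by linarith
  set χ' : ι → ℝ := fun j => χ j / l' with hχ'
  have hχχ : ∀ j, χ j = l' * χ' j := fun j => by rw [hχ']; field_simp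
  have key : ∀ p ∈ P, ∑ i, ∑ j, p i j * (χ' j - dist (x i) (x j)) < ∑ j, χ' j * b j - M := by
    intro p hp
    have h1 := hu (L p) ⟨p, hp, rfl⟩
    have h2 := hv (b, M) ⟨rfl, le_refl M⟩
    rw [hf] at h2
    have hLp : L p = (fun j => ∑ i, p i j, ∑ i, ∑ j, p i j * dist (x i) (x j)) := rfl
    rw [hLp, hf] at h1
    have hd : 0 ≤ ∑ i, ∑ j, p i j * dist (x i) (x j) :=
      Finset.sum_nonneg fun i _ => Finset.sum_nonneg fun j _ => mul_nonneg (hp.1 i j) dist_nonneg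
    have e1 : ∑ j, χ j * ∑ i, p i j = l' * ∑ i, ∑ j, p i j * χ' j := by
      rw [Finset.sum_comm, Finset.mul_sum]
      refine Finset.sum_congr rfl fun j _ => ?_
      rw [hχχ, Finset.mul_sum, Finset.mul_sum]
      exact Finset.sum_congr rfl fun i _ => by ring
    have e2 : ∑ j, χ j * b j = l' * ∑ j, χ' j * b j := by
      rw [Finset.mul_sum]
      exact Finset.sum_congr rfl fun i _ => by rw [hχχ]; ring
    have e3 : ∑ i, ∑ j, p i j * (χ' j - dist (x i) (x j))
       = ∑ i, ∑ j, p i j * χ' j - ∑ i, ∑ j, p i j * dist (x i) (x j) := by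
      simp only [mul_sub, Finset.sum_sub_distrib]
    rw [e3]
    rw [e1] at h1
    rw [e2] at h2
    refine lt_of_mul_lt_mul_left ?_ hl'0.le
    have e4 : l = δ - l' := by rw [hl']; ring
    rw [e4] at h1 h2
    nlinarith
  -- the potential
  set g : X → ℝ≥0 := fun z => Finset.univ.sup fun j => (χ' j - dist z (x j)).toNNReal with hg
  have hgle : ∀ z j, χ' j - dist z (x j) ≤ g z := by
    intro z j
    refine (Real.le_coe_toNNReal _).trans ?_
    exact_mod_cast Finset.le_sup (f := fun j => (χ' j - dist z (x j)).toNNReal) (Finset.mem_univ j)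
  have hglip : ∀ z w, (g z : ℝ) ≤ g w + dist z w := by
    intro z w
    have : g z ≤ g w + ⟨dist z w, dist_nonneg⟩ := by
      refine Finset.sup_le fun j _ => ?_
      rw [Real.toNNReal_le_iff_le_coe]
      push_cast
      have := hgle w j
      have := dist_triangle w z (x j)
      rw [dist_comm w z] at this
      show _ ≤ (g w : ℝ) + dist z w
      linarith
    exact_mod_cast this
  have hq : ∀ i, ∃ q : ι → ℝ, (∀ j, 0 ≤ q j) ∧ ∑ j, q j ≤ 1 ∧
      ∑ j, q j * (χ' j - dist (x i) (x j)) = g (x i) := by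
    intro i
    obtain ⟨k, -, hk⟩ := Finset.exists_mem_eq_sup Finset.univ ⟨i, Finset.mem_univ i⟩
      (fun j => (χ' j - dist (x i) (x j)).toNNReal)
    have hk' : g (x i) = (χ' k - dist (x i) (x k)).toNNReal := hk
    by_cases hpos : 0 ≤ χ' k - dist (x i) (x k)
    · refine ⟨Pi.single k 1, fun j => ?_, ?_, ?_⟩
      · by_cases h : j = k
        · subst h; simp
        · simp [h]
      · simp
      · rw [hk', Real.coe_toNNReal _ hpos]
        simp [Pi.single_apply]
    · refine ⟨0, fun j => le_rfl, by simp, ?_⟩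
      rw [hk', Real.toNNReal_of_nonpos (le_of_not_ge hpos)]
      simp
  choose q hq0 hq1 hq2 using hq
  have h1 := key (fun i j => a i * q i j) ⟨fun i j => mul_nonneg (ha i) (hq0 i j), fun i => by
    rw [← Finset.mul_sum]
    exact mul_le_of_le_one_right (ha i) (hq1 i)⟩
  simp only [mul_assoc, ← Finset.mul_sum, hq2] at h1
  have h2 := hM (fun z => -(g z : ℝ)) (by
    refine LipschitzWith.of_le_add fun z w => ?_
    have := hglip w z
    rw [dist_comm] at this
    linarith) (fun z => by simp)
  have h3 : ∑ j, χ' j * b j ≤ ∑ j, (g (x j) : ℝ) * b j := by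
    refine Finset.sum_le_sum fun j _ => mul_le_mul_of_nonneg_right ?_ (hb j)
    simpa using hgle (x j) j
  have h4 : ∑ i, -(g (x i) : ℝ) * (a i - b i) = ∑ j, (g (x j) : ℝ) * b j - ∑ i, a i * g (x i) := by
    rw [← Finset.sum_sub_distrib]
    exact Finset.sum_congr rfl fun i _ => by ring
  rw [h4] at h2
  linarith

lemma aux_lift {X ι : Type*} [MeasurableSpace X] [Fintype ι] (μ1 μ2 : Measure X)
    [IsFiniteMeasure μ1] [IsFiniteMeasure μ2] (k : X → ι)
    (hk : ∀ i, MeasurableSet (k ⁻¹' {i})) (P : ι → ι → ℝ≥0∞)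
    (hP1 : ∀ i, ∑ j, P i j ≤ μ1 (k ⁻¹' {i})) (hP2 : ∀ j, ∑ i, P i j = μ2 (k ⁻¹' {j})) :
    ∃ π : Measure (X × X), π.map Prod.fst ≤ μ1 ∧ π.map Prod.snd = μ2 ∧
      ∀ w : ι → ι → ℝ≥0∞, ∫⁻ q, w (k q.1) (k q.2) ∂π = ∑ i, ∑ j, P i j * w i j := by
  classical
  set A : ι → Set X := fun i => k ⁻¹' {i} with hA
  set c : ι → ι → ℝ≥0∞ := fun i j => P i j / (μ1 (A i) * μ2 (A j)) with hc
  have hPa : ∀ i j, P i j ≤ μ1 (A i) := fun i j =>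
    (Finset.single_le_sum (f := fun j => P i j) (fun _ _ => zero_le) (Finset.mem_univ j)).trans
      (hP1 i)
  have hPb : ∀ i j, P i j ≤ μ2 (A j) := fun i j =>
    (Finset.single_le_sum (f := fun i => P i j) (fun _ _ => zero_le) (Finset.mem_univ i)).trans
      (hP2 j).le
  have hcP : ∀ i j, c i j * (μ1 (A i) * μ2 (A j)) = P i j := by
    intro i j
    by_cases h : μ1 (A i) * μ2 (A j) = 0
    · have : P i j = 0 := by
        rcases mul_eq_zero.1 h with h | h
        · exact le_antisymm (h ▸ hPa i j) zero_le
        · exact le_antisymm (h ▸ hPb i j) zero_le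
      rw [h, this, mul_zero]
    · exact ENNReal.div_mul_cancel h (ENNReal.mul_ne_top (measure_ne_top _ _) (measure_ne_top _ _))
  have hsum : ∀ (μ : Measure X) (E : Set X), MeasurableSet E → μ E = ∑ i, μ (E ∩ A i) := by
    intro μ E hE
    rw [← measure_biUnion_finset]
    · congr 1
      ext z
      simp [hA]
    · intro i _ j _ hij
      refine Set.disjoint_left.2 ?_
      rintro z ⟨_, h1⟩ ⟨_, h2⟩
      exact hij (h1.symm.trans h2)
    · intro i _
      exact hE.inter (hk i)
  refine ⟨∑ i, ∑ j, c i j • (μ1.restrict (A i)).prod (μ2.restrict (A j)), ?_, ?_, ?_⟩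
  · refine Measure.le_iff.2 fun E hE => ?_
    rw [Measure.map_apply measurable_fst hE, hsum μ1 E hE]
    simp only [Measure.finsetSum_apply, Measure.smul_apply, smul_eq_mul]
    refine Finset.sum_le_sum fun i _ => ?_
    have : ∀ j, ((μ1.restrict (A i)).prod (μ2.restrict (A j))) (Prod.fst ⁻¹' E)
        = μ1 (E ∩ A i) * μ2 (A j) := by
      intro j
      rw [← Set.prod_univ, Measure.prod_prod, Measure.restrict_apply hE,
        Measure.restrict_apply_univ]
    simp only [this]
    by_cases h : μ1 (A i) = 0
    · have h' : μ1 (E ∩ A i) = 0 := measure_mono_null inter_subset_right h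
      simp [h']
    · have hE1 : μ1 (E ∩ A i) = μ1 (E ∩ A i) / μ1 (A i) * μ1 (A i) :=
        (ENNReal.div_mul_cancel h (measure_ne_top _ _)).symm
      calc ∑ j, c i j * (μ1 (E ∩ A i) * μ2 (A j))
          = ∑ j, μ1 (E ∩ A i) / μ1 (A i) * P i j := by
            refine Finset.sum_congr rfl fun j _ => ?_
            rw [← hcP i j]
            conv_lhs => rw [hE1]
            ring
        _ ≤ μ1 (E ∩ A i) / μ1 (A i) * μ1 (A i) := by
            rw [← Finset.mul_sum]
            gcongr
            exact hP1 i
        _ = _ := hE1.symm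
  · refine Measure.ext fun E hE => ?_
    rw [Measure.map_apply measurable_snd hE, hsum μ2 E hE]
    simp only [Measure.finsetSum_apply, Measure.smul_apply, smul_eq_mul]
    rw [Finset.sum_comm]
    refine Finset.sum_congr rfl fun j _ => ?_
    have : ∀ i, ((μ1.restrict (A i)).prod (μ2.restrict (A j))) (Prod.snd ⁻¹' E)
        = μ1 (A i) * μ2 (E ∩ A j) := by
      intro i
      rw [← Set.univ_prod, Measure.prod_prod, Measure.restrict_apply hE,
        Measure.restrict_apply_univ]
    simp only [this]
    by_cases h : μ2 (A j) = 0
    · have h' : μ2 (E ∩ A j) = 0 := measure_mono_null inter_subset_right h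
      simp [h']
    · have hE1 : μ2 (E ∩ A j) = μ2 (E ∩ A j) / μ2 (A j) * μ2 (A j) :=
        (ENNReal.div_mul_cancel h (measure_ne_top _ _)).symm
      calc ∑ i, c i j * (μ1 (A i) * μ2 (E ∩ A j))
          = ∑ i, μ2 (E ∩ A j) / μ2 (A j) * P i j := by
            refine Finset.sum_congr rfl fun i _ => ?_
            rw [← hcP i j]
            conv_lhs => rw [hE1]
            ring
        _ = μ2 (E ∩ A j) / μ2 (A j) * μ2 (A j) := by
            rw [← Finset.mul_sum, hP2 j]
        _ = _ := hE1.symm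
  · intro w
    simp only [lintegral_finsetSum_measure, lintegral_smul_measure, smul_eq_mul]
    refine Finset.sum_congr rfl fun i _ => Finset.sum_congr rfl fun j _ => ?_
    rw [Measure.prod_restrict, setLIntegral_congr_fun (g := fun _ => w i j)
      ((hk i).prod (hk j)) (fun q hq => by
        have h1 : k q.1 = i := hq.1
        have h2 : k q.2 = j := hq.2
        simp only [h1, h2]), setLIntegral_const, Measure.prod_prod, ← hcP i j]
    ring

lemma aux_int {X : Type*} [MetricSpace X]
    [MeasurableSpace X] [BorelSpace X]
    (hX : Bornology.IsBounded (Set.univ : Set X)) (μ : Measure X) [IsFiniteMeasure μ]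
    (ψ : X → ℝ) (hψ : Measurable ψ) (h : ∀ z w, |ψ z - ψ w| ≤ Metric.diam (univ : Set X)) :
    Integrable ψ μ := by
  rcases isEmpty_or_nonempty X with hE | ⟨⟨z0⟩⟩
  · exact Integrable.of_finite
  · refine Integrable.of_bound hψ.aestronglyMeasurable (|ψ z0| + Metric.diam (univ : Set X))
      (ae_of_all _ fun z => ?_)
    have h1 := h z z0
    have h2 := abs_add_le (ψ z - ψ z0) (ψ z0)
    rw [sub_add_cancel] at h2
    rw [Real.norm_eq_abs]
    linarith

lemma aux_dual {X : Type*} [MetricSpace X] 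
    [TopologicalSpace.SeparableSpace X] [MeasurableSpace X] [BorelSpace X]
    (hX : Bornology.IsBounded (Set.univ : Set X))
    (μ1 μ2 : Measure X) [IsFiniteMeasure μ1] [IsFiniteMeasure μ2]
    (C1 C2 : ℝ) (hC1 : 0 < C1) (hC2 : 0 < C2)
    (hdual : ∀ (ψ : X → ℝ) (K : ℝ≥0), LipschitzWith K ψ →
      ∀ Cb : ℝ, (∀ x, |ψ x| ≤ Cb) →
      |(∫ x, ψ x ∂μ1) - ∫ x, ψ x ∂μ2| ≤ C1 * K + C2 * Cb)
    (hm : μ2.real univ ≤ μ1.real univ) (ψ : X → ℝ) (hψ : LipschitzWith 1 ψ) (h0 : ∀ z, ψ z ≤ 0) :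
    ∫ x, ψ x ∂μ1 - ∫ x, ψ x ∂μ2 ≤ C1 + C2 * (Metric.diam (univ : Set X) / 2) := by
  have hD : 0 ≤ Metric.diam (univ : Set X) := Metric.diam_nonneg
  set D := Metric.diam (univ : Set X) with hDdef
  rcases isEmpty_or_nonempty X with hE | hN
  · have : μ1 = 0 := Measure.eq_zero_of_isEmpty _
    have : μ2 = 0 := Measure.eq_zero_of_isEmpty _
    subst_vars
    simp
    positivity
  have hosc : ∀ z w, |ψ z - ψ w| ≤ D := fun z w => by
    have h1 := hψ.dist_le_mul z w
    have h2 := Metric.dist_le_diam_of_mem hX (mem_univ z) (mem_univ w)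
    rw [Real.dist_eq] at h1
    simp at h1
    linarith
  have hbdd : BddAbove (range ψ) := ⟨0, by rintro _ ⟨z, rfl⟩; exact h0 z⟩
  set S := ⨆ z, ψ z with hS
  have hS0 : S ≤ 0 := ciSup_le h0
  have hSle : ∀ z, ψ z ≤ S := fun z => le_ciSup hbdd z
  have hSge : ∀ z, S ≤ ψ z + D := fun z => ciSup_le fun w => by
    have := (abs_le.1 (hosc w z)).2
    linarith
  have h1 : LipschitzWith 1 (fun z => ψ z + (D / 2 - S)) := by
    refine LipschitzWith.of_le_add fun z w => ?_
    have := hψ.dist_le_mul z w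
    rw [Real.dist_eq] at this
    have := (abs_le.1 this).2
    simp at this
    linarith
  have h2 := hdual _ 1 h1 (D / 2) (fun z => by
    rw [abs_le]
    have := hSle z
    have := hSge z
    constructor <;> linarith)
  have hi : ∀ μ : Measure X, ∀ [IsFiniteMeasure μ], Integrable ψ μ := fun μ _ =>
    aux_int hX μ ψ hψ.continuous.measurable hosc
  rw [integral_add (hi μ1) (integrable_const _), integral_add (hi μ2) (integrable_const _),
    integral_const, integral_const] at h2
  have h3 := (abs_le.1 h2).2
  simp only [smul_eq_mul, NNReal.coe_one, mul_one] at h3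
  have : 0 ≤ (μ1.real univ - μ2.real univ) * (D / 2 - S) := by
    apply mul_nonneg <;> linarith
  nlinarith

lemma aux_approx {X : Type*} [MetricSpace X] [Nonempty X]
    [TopologicalSpace.SeparableSpace X] [MeasurableSpace X] [BorelSpace X]
    (hX : Bornology.IsBounded (Set.univ : Set X))
    (μ : Measure X) [IsFiniteMeasure μ] (ε : ℝ) (hε : 0 < ε) :
    ∃ (n : ℕ) (x : Fin n → X) (k : X → Fin n), (∀ i, MeasurableSet (k ⁻¹' {i})) ∧
      ∫⁻ z, ENNReal.ofReal (dist z (x (k z))) ∂μ ≤ ENNReal.ofReal ε := by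
  let e := TopologicalSpace.denseSeq X
  have ht : Tendsto (fun N => ∫⁻ z, ENNReal.ofReal (dist z (SimpleFunc.nearestPt e N z)) ∂μ)
      atTop (𝓝 (∫⁻ z, 0 ∂μ)) := by
    refine tendsto_lintegral_of_dominated_convergence
      (fun _ => ENNReal.ofReal (Metric.diam (univ : Set X))) ?_ ?_ ?_ ?_
    · intro n
      have := (SimpleFunc.nearestPt e n).measurable
      exact (measurable_id.dist this).ennreal_ofReal
    · intro n
      exact ae_of_all _ fun z => ENNReal.ofReal_le_ofReal
        (Metric.dist_le_diam_of_mem hX (mem_univ _) (mem_univ _))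
    · rw [lintegral_const]
      exact ENNReal.mul_ne_top ENNReal.ofReal_ne_top (measure_ne_top _ _)
    · refine ae_of_all _ fun z => ?_
      have h : Tendsto (fun N => SimpleFunc.nearestPt e N z) atTop (𝓝 z) :=
        SimpleFunc.tendsto_nearestPt (by
          rw [(TopologicalSpace.denseRange_denseSeq X).closure_range]; trivial)
      have h2 : Tendsto (fun N => dist z (SimpleFunc.nearestPt e N z)) atTop (𝓝 (dist z z)) :=
        tendsto_const_nhds.dist h
      have := ENNReal.tendsto_ofReal h2
      simpa using this
  rw [lintegral_zero] at ht
  obtain ⟨N, hN⟩ := (ht.eventually (gt_mem_nhds (ENNReal.ofReal_pos.2 hε))).exists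
  refine ⟨N + 1, fun i => e i, fun z => ⟨SimpleFunc.nearestPtInd e N z,
    Nat.lt_succ_of_le (SimpleFunc.nearestPtInd_le e N z)⟩, fun i => ?_, hN.le⟩
  have := (SimpleFunc.nearestPtInd e N).measurableSet_fiber i
  convert this using 1
  ext z
  simp [Fin.ext_iff]

lemma aux_main {X : Type*} [MetricSpace X]
    [TopologicalSpace.SeparableSpace X] [MeasurableSpace X] [BorelSpace X]
    (hX : Bornology.IsBounded (Set.univ : Set X))
    (μ1 μ2 : Measure X) [IsFiniteMeasure μ1] [IsFiniteMeasure μ2]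
    (M : ℝ) (hM : ∀ ψ : X → ℝ, LipschitzWith 1 ψ → (∀ z, ψ z ≤ 0) →
      ∫ x, ψ x ∂μ1 - ∫ x, ψ x ∂μ2 ≤ M) (ε : ℝ) (hε : 0 < ε) :
    ∃ π : Measure (X × X), π.map Prod.fst ≤ μ1 ∧ π.map Prod.snd = μ2 ∧
      ∫⁻ q, ENNReal.ofReal (dist q.1 q.2) ∂π ≤ ENNReal.ofReal (M + 2 * ε) := by
  classical
  rcases isEmpty_or_nonempty X with hE | hN
  · have h1 : μ1 = 0 := Measure.eq_zero_of_isEmpty _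
    have h2 : μ2 = 0 := Measure.eq_zero_of_isEmpty _
    exact ⟨0, by simp, by simp [h2], by simp⟩
  have hM0 : 0 ≤ M := by
    have := hM (fun _ => 0) (LipschitzWith.const' 0 |>.weaken zero_le_one) (fun _ => le_rfl)
    simpa using this
  obtain ⟨n, x, k, hk, hint⟩ := aux_approx hX (μ1 + μ2) ε hε
  have hkm : Measurable k := measurable_to_countable' hk
  have hxm : Measurable fun z => x (k z) := (measurable_of_finite x).comp hkm
  have hdm : Measurable fun z => dist z (x (k z)) := measurable_id.dist hxm
  have hdD : ∀ z w : X, dist z w ≤ Metric.diam (univ : Set X) := fun z w =>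
    Metric.dist_le_diam_of_mem hX (mem_univ z) (mem_univ w)
  have hdi : ∀ μ : Measure X, ∀ [IsFiniteMeasure μ], Integrable (fun z => dist z (x (k z))) μ :=
    fun μ _ => Integrable.of_bound hdm.aestronglyMeasurable (Metric.diam (univ : Set X))
      (ae_of_all _ fun z => by rw [Real.norm_eq_abs, abs_of_nonneg dist_nonneg]; exact hdD _ _)
  have hintR : ∫ z, dist z (x (k z)) ∂μ1 + ∫ z, dist z (x (k z)) ∂μ2 ≤ ε := by
    rw [← integral_add_measure (hdi μ1) (hdi μ2)]
    rw [← ofReal_integral_eq_lintegral_ofReal (hdi _) (ae_of_all _ fun _ => dist_nonneg)] at hint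
    exact (ENNReal.ofReal_le_ofReal_iff hε.le).1 hint
  have hdisc : ∀ ψ : X → ℝ, LipschitzWith 1 ψ → (∀ z, ψ z ≤ 0) →
      ∑ i, ψ (x i) * (μ1.real (k ⁻¹' {i}) - μ2.real (k ⁻¹' {i})) ≤ M + ε := by
    intro ψ hψ h0
    have hψd : ∀ z w, |ψ z - ψ w| ≤ dist z w := fun z w => by
      have := hψ.dist_le_mul z w
      rw [Real.dist_eq] at this
      simpa using this
    have hosc : ∀ z w, |ψ z - ψ w| ≤ Metric.diam (univ : Set X) := fun z w =>
      (hψd z w).trans (hdD z w)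
    have hi : ∀ μ : Measure X, ∀ [IsFiniteMeasure μ], Integrable ψ μ := fun μ _ =>
      aux_int hX μ ψ hψ.continuous.measurable hosc
    have hik : ∀ μ : Measure X, ∀ [IsFiniteMeasure μ], Integrable (fun z => ψ (x (k z))) μ :=
      fun μ _ => aux_int hX μ _ (hψ.continuous.measurable.comp hxm) fun z w => hosc _ _
    have hsum : ∀ μ : Measure X, ∀ [IsFiniteMeasure μ],
        ∫ z, ψ (x (k z)) ∂μ = ∑ i, ψ (x i) * μ.real (k ⁻¹' {i}) := by
      intro μ _
      have h1 := integral_map (μ := μ) hkm.aemeasurable (f := fun i => ψ (x i))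
        (measurable_of_finite _).aestronglyMeasurable
      rw [← h1, integral_fintype Integrable.of_finite]
      refine Finset.sum_congr rfl fun i _ => ?_
      rw [map_measureReal_apply hkm (measurableSet_singleton i), smul_eq_mul, mul_comm]
    have e : ∑ i, ψ (x i) * (μ1.real (k ⁻¹' {i}) - μ2.real (k ⁻¹' {i}))
        = ∫ z, ψ (x (k z)) ∂μ1 - ∫ z, ψ (x (k z)) ∂μ2 := by
      rw [hsum, hsum, ← Finset.sum_sub_distrib]
      exact Finset.sum_congr rfl fun i _ => by ring
    rw [e]
    have i1 : ∫ z, ψ (x (k z)) ∂μ1 ≤ ∫ z, ψ z ∂μ1 + ∫ z, dist z (x (k z)) ∂μ1 := by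
      rw [← integral_add (hi μ1) (hdi μ1)]
      refine integral_mono (hik μ1) ((hi μ1).add (hdi μ1)) fun z => ?_
      have := (abs_le.1 (hψd z (x (k z)))).1
      simp only [Pi.add_apply]
      linarith
    have i2 : ∫ z, ψ z ∂μ2 ≤ ∫ z, ψ (x (k z)) ∂μ2 + ∫ z, dist z (x (k z)) ∂μ2 := by
      rw [← integral_add (hik μ2) (hdi μ2)]
      refine integral_mono (hi μ2) ((hik μ2).add (hdi μ2)) fun z => ?_
      have := (abs_le.1 (hψd z (x (k z)))).2
      simp only [Pi.add_apply]
      linarith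
    have := hM ψ hψ h0
    linarith
  obtain ⟨p, hp0, hp1, hp2, hpc⟩ := aux_lp x (fun i => μ1.real (k ⁻¹' {i}))
    (fun i => μ2.real (k ⁻¹' {i})) (fun _ => measureReal_nonneg) (fun _ => measureReal_nonneg)
    (M + ε) hdisc
  obtain ⟨π, h1, h2, h3⟩ := aux_lift μ1 μ2 k hk (fun i j => ENNReal.ofReal (p i j))
    (fun i => by
      rw [← ENNReal.ofReal_sum_of_nonneg fun j _ => hp0 i j,
        ← ofReal_measureReal (measure_ne_top _ _)]
      exact ENNReal.ofReal_le_ofReal (hp1 i))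
    (fun j => by
      rw [← ENNReal.ofReal_sum_of_nonneg fun i _ => hp0 i j,
        ← ofReal_measureReal (measure_ne_top _ _), hp2 j])
  refine ⟨π, h1, h2, ?_⟩
  have hmid : ∫⁻ q, ENNReal.ofReal (dist (x (k q.1)) (x (k q.2))) ∂π ≤ ENNReal.ofReal (M + ε) := by
    rw [h3 fun i j => ENNReal.ofReal (dist (x i) (x j))]
    refine le_trans (le_of_eq ?_) (ENNReal.ofReal_le_ofReal hpc)
    rw [ENNReal.ofReal_sum_of_nonneg fun i _ => Finset.sum_nonneg fun j _ =>
      mul_nonneg (hp0 i j) dist_nonneg]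
    refine Finset.sum_congr rfl fun i _ => ?_
    rw [ENNReal.ofReal_sum_of_nonneg fun j _ => mul_nonneg (hp0 i j) dist_nonneg]
    exact Finset.sum_congr rfl fun j _ => (ENNReal.ofReal_mul (hp0 i j)).symm
  have hd : Measurable fun z => ENNReal.ofReal (dist z (x (k z))) := hdm.ennreal_ofReal
  have hleft : ∫⁻ q, ENNReal.ofReal (dist q.1 (x (k q.1))) ∂π
      ≤ ∫⁻ z, ENNReal.ofReal (dist z (x (k z))) ∂μ1 := by
    rw [← lintegral_map hd measurable_fst]
    exact lintegral_mono' h1 le_rfl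
  have hright : ∫⁻ q, ENNReal.ofReal (dist q.2 (x (k q.2))) ∂π
      ≤ ∫⁻ z, ENNReal.ofReal (dist z (x (k z))) ∂μ2 := by
    rw [← lintegral_map hd measurable_snd]
    exact lintegral_mono' h2.le le_rfl
  rw [lintegral_add_measure] at hint
  calc ∫⁻ q, ENNReal.ofReal (dist q.1 q.2) ∂π
      ≤ ∫⁻ q, (ENNReal.ofReal (dist q.1 (x (k q.1))) + ENNReal.ofReal (dist q.2 (x (k q.2)))
          + ENNReal.ofReal (dist (x (k q.1)) (x (k q.2)))) ∂π := by
        refine lintegral_mono fun q => ?_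
        rw [← ENNReal.ofReal_add dist_nonneg dist_nonneg,
          ← ENNReal.ofReal_add (by positivity) dist_nonneg]
        refine ENNReal.ofReal_le_ofReal ?_
        have := dist_triangle4 q.1 (x (k q.1)) (x (k q.2)) q.2
        rw [dist_comm (x (k q.2)) q.2] at this
        linarith
    _ = ∫⁻ q, ENNReal.ofReal (dist q.1 (x (k q.1))) ∂π
        + ∫⁻ q, ENNReal.ofReal (dist q.2 (x (k q.2))) ∂π
        + ∫⁻ q, ENNReal.ofReal (dist (x (k q.1)) (x (k q.2))) ∂π := by
        rw [lintegral_add_left, lintegral_add_left]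
        · exact hd.comp measurable_fst
        · exact (hd.comp measurable_fst).add (hd.comp measurable_snd)
    _ ≤ ENNReal.ofReal ε + ENNReal.ofReal (M + ε) :=
        add_le_add ((add_le_add hleft hright).trans hint) hmid
    _ = ENNReal.ofReal (M + 2 * ε) := by
        rw [← ENNReal.ofReal_add hε.le (by linarith)]
        congr 1; ring

lemma aux_half {X : Type*} [MetricSpace X]
    [TopologicalSpace.SeparableSpace X] [MeasurableSpace X] [BorelSpace X]
    (hX : Bornology.IsBounded (Set.univ : Set X))
    (μ1 μ2 : Measure X) [IsFiniteMeasure μ1] [IsFiniteMeasure μ2]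
    (C1 C2 : ℝ) (hC1 : 0 < C1) (hC2 : 0 < C2)
    (hdual : ∀ (ψ : X → ℝ) (K : ℝ≥0), LipschitzWith K ψ →
      ∀ Cb : ℝ, (∀ x, |ψ x| ≤ Cb) →
      |(∫ x, ψ x ∂μ1) - ∫ x, ψ x ∂μ2| ≤ C1 * K + C2 * Cb)
    (hm : μ2.real univ ≤ μ1.real univ) :
    ∃ π : Measure (X × X), π.map Prod.fst ≤ μ1 ∧ π.map Prod.snd = μ2 ∧
      μ1 univ ≤ μ2 univ + ENNReal.ofReal C2 ∧
      ∫⁻ q, ENNReal.ofReal (dist q.1 q.2) ∂π ≤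
        ENNReal.ofReal (C1 + C2 * Metric.diam (Set.univ : Set X)) := by
  have hmass : μ1 univ ≤ μ2 univ + ENNReal.ofReal C2 := by
    have h := hdual (fun _ => 1) 0 (LipschitzWith.const' 1) 1 (by simp)
    simp only [integral_const, smul_eq_mul, mul_one, NNReal.coe_zero, mul_zero, zero_add] at h
    have h' := (abs_le.1 h).2
    rw [← ofReal_measureReal (measure_ne_top μ1 univ), ← ofReal_measureReal (measure_ne_top μ2 univ),
      ← ENNReal.ofReal_add measureReal_nonneg hC2.le]
    exact ENNReal.ofReal_le_ofReal (by linarith)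
  have hMM := aux_dual hX μ1 μ2 C1 C2 hC1 hC2 hdual hm
  have hD : 0 ≤ Metric.diam (univ : Set X) := Metric.diam_nonneg
  rcases hD.eq_or_lt with h0 | h0
  · obtain ⟨π, h1, h2, -⟩ := aux_main hX μ1 μ2 _ hMM 1 one_pos
    refine ⟨π, h1, h2, hmass, ?_⟩
    have : ∀ z w : X, dist z w = 0 := fun z w => le_antisymm
      (h0 ▸ Metric.dist_le_diam_of_mem hX (mem_univ z) (mem_univ w)) dist_nonneg
    simp [this]
  · obtain ⟨π, h1, h2, h3⟩ := aux_main hX μ1 μ2 _ hMM (C2 * Metric.diam (univ : Set X) / 4)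
      (by positivity)
    refine ⟨π, h1, h2, hmass, h3.trans (ENNReal.ofReal_le_ofReal (le_of_eq (by ring)))⟩

/-- If two finite measures on a bounded complete separable metric space
satisfy the duality-type estimate `|∫ψ dμ₁ − ∫ψ dμ₂| ≤ C₁ Lip(ψ) + C₂ ‖ψ‖_∞` for all
bounded Lipschitz `ψ`, then after removing mass at most `C₂` from each one, the remaining
parts have equal mass and can be coupled by a transport plan of cost at most
`C₁ + C₂ diam X`. -/
theorem stmt4 {X : Type*} [MetricSpace X] [CompleteSpace X]
    [TopologicalSpace.SeparableSpace X] [MeasurableSpace X] [BorelSpace X]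
    (hX : Bornology.IsBounded (Set.univ : Set X))
    (μ1 μ2 : Measure X) [IsFiniteMeasure μ1] [IsFiniteMeasure μ2]
    (C1 C2 : ℝ) (hC1 : 0 < C1) (hC2 : 0 < C2)
    (hdual : ∀ (ψ : X → ℝ) (K : ℝ≥0), LipschitzWith K ψ →
      ∀ Cb : ℝ, (∀ x, |ψ x| ≤ Cb) →
      |(∫ x, ψ x ∂μ1) - ∫ x, ψ x ∂μ2| ≤ C1 * K + C2 * Cb) :
    ∃ ν1 ν2 : Measure X, ν1 ≤ μ1 ∧ ν2 ≤ μ2 ∧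
      μ1 Set.univ ≤ ν1 Set.univ + ENNReal.ofReal C2 ∧
      μ2 Set.univ ≤ ν2 Set.univ + ENNReal.ofReal C2 ∧
      ν1 Set.univ = ν2 Set.univ ∧
      ∃ π : Measure (X × X), π.map Prod.fst = ν1 ∧ π.map Prod.snd = ν2 ∧
        (∫⁻ q : X × X, ENNReal.ofReal (dist q.1 q.2) ∂π) ≤
          ENNReal.ofReal (C1 + C2 * Metric.diam (Set.univ : Set X)) := by
  rcases le_total (μ2.real univ) (μ1.real univ) with hm | hm
  · obtain ⟨π, h1, h2, h3, h4⟩ := aux_half hX μ1 μ2 C1 C2 hC1 hC2 hdual hm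
    have e : π.map Prod.fst univ = μ2 univ := by
      rw [← h2, Measure.map_apply measurable_fst MeasurableSet.univ,
        Measure.map_apply measurable_snd MeasurableSet.univ, preimage_univ, preimage_univ]
    exact ⟨π.map Prod.fst, μ2, h1, le_rfl, by rw [e]; exact h3, le_self_add, e, π, rfl, h2, h4⟩
  · obtain ⟨π, h1, h2, h3, h4⟩ := aux_half hX μ2 μ1 C1 C2 hC1 hC2
      (fun ψ K hψ Cb hCb => by rw [abs_sub_comm]; exact hdual ψ K hψ Cb hCb) hm
    have e : π.map Prod.fst univ = μ1 univ := by
      rw [← h2, Measure.map_apply measurable_fst MeasurableSet.univ,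
        Measure.map_apply measurable_snd MeasurableSet.univ, preimage_univ, preimage_univ]
    refine ⟨μ1, π.map Prod.fst, le_rfl, h1, le_self_add, by rw [e]; exact h3, e.symm,
      π.map Prod.swap, ?_, ?_, ?_⟩
    · rw [Measure.map_map measurable_fst measurable_swap]
      exact h2
    · rw [Measure.map_map measurable_snd measurable_swap]
      rfl
    · rw [lintegral_map (by fun_prop) measurable_swap]
      simpa only [Prod.fst_swap, Prod.snd_swap, dist_comm] using h4
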